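/- Let n ≥ 1 and let x, y ∈ ℝⁿ with ‖x‖ = ‖y‖ = 1. Let γ be the standard Gaussian measure on ℝⁿ (the n-fold product of the standard real Gaussian N(0,1)). Then ∫_{ℝⁿ} sign(⟪x,g⟫)·sign(⟪y,g⟫) dγ(g) = (2/π)·arcsin(⟪x,y⟫); equivalently, ⟪x,y⟫ = sin((π/2)·∫ sign(⟪x,g⟫)·sign(⟪y,g⟫) dγ(g)). -/

import Mathlib

open MeasureTheory ProbabilityTheory

open Set

/-- Exponential characteristic functional of a linear form under the product of standard
Gaussians. -/
lemma integral_cexp_sum_pi_gaussianReal {ι : Type*} [Fintype ι] (a : ι → ℝ) :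
    ∫ g : ι → ℝ, Complex.exp ((∑ i, a i * g i : ℝ) * Complex.I)
      ∂(Measure.pi fun _ => gaussianReal 0 1) =
      Complex.exp (-((∑ i, a i ^ 2 : ℝ) : ℂ) / 2) := by
  have h : ∀ g : ι → ℝ, Complex.exp ((∑ i, a i * g i : ℝ) * Complex.I) =
      ∏ i, Complex.exp (a i * g i * Complex.I) := by
    intro g
    rw [← Complex.exp_sum]
    push_cast
    rw [Finset.sum_mul]
  simp_rw [h]
  rw [integral_fintype_prod_eq_prod (f := fun i (t : ℝ) => Complex.exp (a i * t * Complex.I))]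
  simp_rw [← charFun_apply_real, charFun_gaussianReal]
  rw [← Complex.exp_sum]
  congr 1
  push_cast
  simp [Finset.sum_div, neg_div]

/-- The characteristic function of the joint law of two linear forms under the standard Gaussian
measure. -/
lemma charFunDual_map_linearForms_pi_gaussianReal {ι : Type*} [Fintype ι] (x y : ι → ℝ)
    (L : StrongDual ℝ (ℝ × ℝ)) :
    charFunDual ((Measure.pi fun _ : ι => gaussianReal 0 1).map
        (fun g => (∑ i, x i * g i, ∑ i, y i * g i))) L =
      Complex.exp (-((L (1, 0) ^ 2 * ∑ i, x i ^ 2 + 2 * L (1, 0) * L (0, 1) * ∑ i, x i * y i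
        + L (0, 1) ^ 2 * ∑ i, y i ^ 2 : ℝ) : ℂ) / 2) := by
  have hL : ∀ s t : ℝ, L (s, t) = L (1, 0) * s + L (0, 1) * t := by
    intro s t
    have : ((s, t) : ℝ × ℝ) = s • (1, 0) + t • (0, 1) := by simp
    rw [this, map_add, map_smul, map_smul, smul_eq_mul, smul_eq_mul]
    ring
  rw [charFunDual_apply, integral_map (by fun_prop) (by fun_prop)]
  have h : ∀ g : ι → ℝ, L (∑ i, x i * g i, ∑ i, y i * g i) =
      ∑ i, (L (1, 0) * x i + L (0, 1) * y i) * g i := by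
    intro g
    rw [hL, Finset.mul_sum, Finset.mul_sum, ← Finset.sum_add_distrib]
    exact Finset.sum_congr rfl fun i _ => by ring
  simp_rw [h]
  rw [integral_cexp_sum_pi_gaussianReal]
  congr 4
  rw [Finset.mul_sum, Finset.mul_sum, Finset.mul_sum, ← Finset.sum_add_distrib,
    ← Finset.sum_add_distrib]
  exact Finset.sum_congr rfl fun i _ => by ring

/-- The joint law of two linear forms under the standard Gaussian measure depends only on their
Gram matrix. -/
lemma map_linearForms_pi_gaussianReal_eq {ι κ : Type*} [Fintype ι] [Fintype κ]
    {x y : ι → ℝ} {u v : κ → ℝ}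
    (hxx : ∑ i, x i ^ 2 = ∑ j, u j ^ 2) (hyy : ∑ i, y i ^ 2 = ∑ j, v j ^ 2)
    (hxy : ∑ i, x i * y i = ∑ j, u j * v j) :
    (Measure.pi fun _ : ι => gaussianReal 0 1).map
        (fun g => (∑ i, x i * g i, ∑ i, y i * g i)) =
      (Measure.pi fun _ : κ => gaussianReal 0 1).map
        (fun g => (∑ j, u j * g j, ∑ j, v j * g j)) := by
  apply Measure.ext_of_charFunDual
  ext L
  rw [charFunDual_map_linearForms_pi_gaussianReal, charFunDual_map_linearForms_pi_gaussianReal,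
    hxx, hyy, hxy]

lemma measurable_real_sign : Measurable Real.sign :=
  Measurable.ite measurableSet_Iio measurable_const
    (Measurable.ite measurableSet_Ioi measurable_const measurable_const)

/-- Integrating against the standard Gaussian measure of the plane in polar coordinates. -/
lemma integral_prod_gaussianReal_eq_polarCoord (F : ℝ × ℝ → ℝ) :
    ∫ p, F p ∂((gaussianReal 0 1).prod (gaussianReal 0 1)) =
      ∫ p in Ioi (0 : ℝ) ×ˢ Ioo (-Real.pi) Real.pi,
        (p.1 * ((2 * Real.pi)⁻¹ * Real.exp (-p.1 ^ 2 / 2))) *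
          F (p.1 * Real.cos p.2, p.1 * Real.sin p.2) := by
  rw [gaussianReal_of_var_ne_zero 0 one_ne_zero,
    prod_withDensity (by fun_prop) (by fun_prop), ← Measure.volume_eq_prod,
    integral_withDensity_eq_integral_toReal_smul (by fun_prop)
      (ae_of_all _ fun p => ENNReal.mul_lt_top gaussianPDF_lt_top gaussianPDF_lt_top),
    ← integral_comp_polarCoord_symm]
  simp only [polarCoord_target, polarCoord_symm_apply, ENNReal.toReal_mul, toReal_gaussianPDF,
    smul_eq_mul]
  congr 1 with p
  rw [← mul_assoc]
  congr 2
  simp only [gaussianPDFReal, NNReal.coe_one, mul_one, sub_zero]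
  have h : Real.sqrt (2 * Real.pi) * Real.sqrt (2 * Real.pi) = 2 * Real.pi :=
    Real.mul_self_sqrt (by positivity)
  rw [mul_mul_mul_comm, ← mul_inv, h, ← Real.exp_add]
  congr 2
  linear_combination (-p.1 ^ 2 / 2) * Real.sin_sq_add_cos_sq p.2

/-- A function of the angle alone is integrated by the standard Gaussian measure of the plane as
by the uniform measure on the circle. -/
lemma integral_prod_gaussianReal_of_polar {F : ℝ × ℝ → ℝ} {G : ℝ → ℝ}
    (hFG : ∀ r θ : ℝ, 0 < r → F (r * Real.cos θ, r * Real.sin θ) = G θ) :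
    ∫ p, F p ∂((gaussianReal 0 1).prod (gaussianReal 0 1)) =
      (2 * Real.pi)⁻¹ * ∫ θ in Ioo (-Real.pi) Real.pi, G θ := by
  have key : ∀ {F : ℝ × ℝ → ℝ} {G : ℝ → ℝ},
      (∀ r θ : ℝ, 0 < r → F (r * Real.cos θ, r * Real.sin θ) = G θ) →
      ∫ p, F p ∂((gaussianReal 0 1).prod (gaussianReal 0 1)) =
        (∫ r in Ioi (0 : ℝ), r * ((2 * Real.pi)⁻¹ * Real.exp (-r ^ 2 / 2))) *
          ∫ θ in Ioo (-Real.pi) Real.pi, G θ := by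
    intro F G hFG
    rw [integral_prod_gaussianReal_eq_polarCoord, ← setIntegral_prod_mul,
      ← Measure.volume_eq_prod]
    refine setIntegral_congr_fun (measurableSet_Ioi.prod measurableSet_Ioo) fun p hp => ?_
    simp only [hFG p.1 p.2 hp.1]
  have h1 := key (F := fun _ => 1) (G := fun _ => 1) fun _ _ _ => rfl
  rw [key hFG]
  congr 1
  simp only [integral_const, probReal_univ, smul_eq_mul, mul_one, measureReal_restrict_apply_univ,
    Real.volume_real_Ioo_of_le (by linarith [Real.pi_pos] : -Real.pi ≤ Real.pi)] at h1
  rw [sub_neg_eq_add, ← two_mul] at h1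
  exact eq_inv_of_mul_eq_one_left h1.symm

/-- The angular integral behind Grothendieck's identity. -/
lemma integral_sign_cos_mul_sign_cos_sub {θ : ℝ} (h0 : 0 ≤ θ) (hpi : θ ≤ Real.pi) :
    ∫ φ in Ioo (-Real.pi) Real.pi, Real.sign (Real.cos φ) * Real.sign (Real.cos (φ - θ)) =
      2 * (Real.pi - 2 * θ) := by
  have hπ := Real.pi_pos
  set f : ℝ → ℝ := fun φ => Real.sign (Real.cos φ) * Real.sign (Real.cos (φ - θ)) with hf
  have hper : Function.Periodic f Real.pi := by
    intro φ
    simp only [hf]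
    rw [show φ + Real.pi - θ = φ - θ + Real.pi by ring, Real.cos_add_pi, Real.cos_add_pi,
      Real.sign_neg, Real.sign_neg, neg_mul_neg]
  have hint : ∀ a b, IntervalIntegrable f volume a b := by
    intro a b
    have hm : Measurable f := (measurable_real_sign.comp (by fun_prop)).mul
      (measurable_real_sign.comp (by fun_prop))
    refine (intervalIntegrable_const (c := (1 : ℝ))).mono_fun hm.aestronglyMeasurable
      (ae_of_all _ fun φ => ?_)
    simp only [hf]
    rcases Real.sign_apply_eq (Real.cos φ) with h | h | h <;>
      rcases Real.sign_apply_eq (Real.cos (φ - θ)) with h' | h' | h' <;> simp [h, h']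
  have hneg : ∫ φ in (-(Real.pi / 2))..(θ - Real.pi / 2), f φ = -θ := by
    rw [intervalIntegral.integral_congr_Ioo_of_le (g := fun _ => (-1 : ℝ)) (by linarith)]
    · simp
    · intro φ hφ
      have h₂ : Real.cos (φ - θ) < 0 := by
        rw [← Real.cos_neg]
        exact Real.cos_neg_of_pi_div_two_lt_of_lt (by linarith [hφ.2]) (by linarith [hφ.1])
      have h₁ : 0 < Real.cos φ := Real.cos_pos_of_mem_Ioo ⟨hφ.1, by linarith [hφ.2]⟩
      simp only [hf, Real.sign_of_pos h₁, Real.sign_of_neg h₂, one_mul]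
  have hpos : ∫ φ in (θ - Real.pi / 2)..(Real.pi / 2), f φ = Real.pi - θ := by
    rw [intervalIntegral.integral_congr_Ioo_of_le (g := fun _ => (1 : ℝ)) (by linarith)]
    · simp
      ring
    · intro φ hφ
      have h₂ : 0 < Real.cos (φ - θ) :=
        Real.cos_pos_of_mem_Ioo ⟨by linarith [hφ.1], by linarith [hφ.2]⟩
      have h₁ : 0 < Real.cos φ := Real.cos_pos_of_mem_Ioo ⟨by linarith [hφ.1], hφ.2⟩
      simp only [hf, Real.sign_of_pos h₁, Real.sign_of_pos h₂, one_mul]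
  have hhalf : ∫ φ in (-(Real.pi / 2))..(Real.pi / 2), f φ = Real.pi - 2 * θ := by
    rw [← intervalIntegral.integral_add_adjacent_intervals (hint _ (θ - Real.pi / 2)) (hint _ _),
      hneg, hpos]
    ring
  have h1 : ∫ φ in (-Real.pi)..0, f φ = Real.pi - 2 * θ := by
    rw [← hhalf]
    have := hper.intervalIntegral_add_eq (-Real.pi) (-(Real.pi / 2))
    convert this using 2 <;> ring
  have h2 : ∫ φ in 0..Real.pi, f φ = Real.pi - 2 * θ := by
    rw [← hhalf]
    have := hper.intervalIntegral_add_eq 0 (-(Real.pi / 2))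
    convert this using 2 <;> ring
  rw [← integral_Ioc_eq_integral_Ioo, ← intervalIntegral.integral_of_le (by linarith),
    ← intervalIntegral.integral_add_adjacent_intervals (hint _ 0) (hint _ _), h1, h2]
  ring

/-- The planar case of Grothendieck's identity. -/
lemma integral_sign_mul_sign_prod_gaussianReal {θ : ℝ} (h0 : 0 ≤ θ) (hpi : θ ≤ Real.pi) :
    ∫ p : ℝ × ℝ, Real.sign p.1 * Real.sign (Real.cos θ * p.1 + Real.sin θ * p.2)
      ∂((gaussianReal 0 1).prod (gaussianReal 0 1)) = 1 - 2 / Real.pi * θ := by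
  have sign_mul_of_pos : ∀ r t : ℝ, 0 < r → Real.sign (r * t) = Real.sign t := by
    intro r t hr
    have hneg : r * t < 0 ↔ t < 0 := by simpa using smul_neg_iff_of_pos_left (b := t) hr
    simp only [Real.sign, hneg, mul_pos_iff_of_pos_left hr]
  rw [integral_prod_gaussianReal_of_polar
    (G := fun φ => Real.sign (Real.cos φ) * Real.sign (Real.cos (φ - θ))),
    integral_sign_cos_mul_sign_cos_sub h0 hpi]
  · field_simp [Real.pi_ne_zero]
  · intro r φ hr
    simp only
    rw [sign_mul_of_pos _ _ hr, ← sign_mul_of_pos r (Real.cos (φ - θ)) hr, Real.cos_sub]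
    congr 2
    ring

/-- **Grothendieck's identity**: for unit vectors `x, y ∈ ℝⁿ` and `γ` the standard Gaussian
measure on `ℝⁿ`, `∫ sign⟪x,g⟫·sign⟪y,g⟫ dγ(g) = (2/π)·arcsin⟪x,y⟫`; equivalently
`⟪x,y⟫ = sin((π/2)·∫ sign⟪x,g⟫·sign⟪y,g⟫ dγ(g))`. -/
theorem grothendieck_identity
    (n : ℕ) (hn : 1 ≤ n) (x y : Fin n → ℝ)
    (hx : ∑ i, x i ^ 2 = 1) (hy : ∑ i, y i ^ 2 = 1) :
    (∫ g : Fin n → ℝ,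
        Real.sign (∑ i, x i * g i) * Real.sign (∑ i, y i * g i)
          ∂(Measure.pi fun _ => gaussianReal 0 1))
      = (2 / Real.pi) * Real.arcsin (∑ i, x i * y i) ∧
    (∑ i, x i * y i)
      = Real.sin ((Real.pi / 2) *
          ∫ g : Fin n → ℝ,
            Real.sign (∑ i, x i * g i) * Real.sign (∑ i, y i * g i)
              ∂(Measure.pi fun _ => gaussianReal 0 1)) := by
  have hc : (∑ i, x i * y i) ^ 2 ≤ 1 := by
    simpa [hx, hy] using Finset.sum_mul_sq_le_sq_mul_sq Finset.univ x y
  obtain ⟨hc₁, hc₂⟩ := abs_le.1 ((sq_le_one_iff_abs_le_one _).1 hc)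
  have hmeas : Measurable fun p : ℝ × ℝ => Real.sign p.1 * Real.sign p.2 :=
    (measurable_real_sign.comp measurable_fst).mul (measurable_real_sign.comp measurable_snd)
  have main : (∫ g : Fin n → ℝ, Real.sign (∑ i, x i * g i) * Real.sign (∑ i, y i * g i)
      ∂(Measure.pi fun _ => gaussianReal 0 1)) =
      (2 / Real.pi) * Real.arcsin (∑ i, x i * y i) := by
    set c := ∑ i, x i * y i with hc_def
    set θ := Real.arccos c with hθ
    have hlaw := map_linearForms_pi_gaussianReal_eq (x := x) (y := y)
      (u := ![1, 0]) (v := ![Real.cos θ, Real.sin θ]) (by simp [hx]) (by simp [hy])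
      (by simp [hθ, Real.cos_arccos hc₁ hc₂, ← hc_def])
    have hint := congrArg (fun μ => ∫ p : ℝ × ℝ, Real.sign p.1 * Real.sign p.2 ∂μ) hlaw
    rw [integral_map (by fun_prop) hmeas.aestronglyMeasurable,
      integral_map (by fun_prop) hmeas.aestronglyMeasurable] at hint
    rw [hint]
    have h2 := integral_sign_mul_sign_prod_gaussianReal (Real.arccos_nonneg c)
      (Real.arccos_le_pi c)
    rw [← (measurePreserving_finTwoArrow (gaussianReal 0 1)).integral_comp'] at h2
    simp only [Fin.sum_univ_two, Matrix.cons_val_zero, Matrix.cons_val_one, one_mul, zero_mul,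
      add_zero]
    refine h2.trans ?_
    rw [Real.arccos]
    field_simp [Real.pi_ne_zero]
    ring
  refine ⟨main, ?_⟩
  rw [main, ← mul_assoc, div_mul_div_comm, mul_comm Real.pi 2,
    div_self (by positivity), one_mul, Real.sin_arcsin hc₁ hc₂]
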